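/- Let A = R/I be a graded Artinian Gorenstein quotient of R = K[w,x,y,z] of socle degree j whose Hilbert function H satisfies H_1 = 4 and H_2 = 7. Then ΔH_{≤ j/2} is an O-sequence; that is, ΔH_i = H_i − H_{i−1} is nonnegative for 0 ≤ i ≤ ⌊j/2⌋ and the sequence (ΔH_0, …, ΔH_{⌊j/2⌋}) (with ΔH_0 = 1) satisfies Macaulay's growth condition ΔH_{i+1} ≤ (ΔH_i)^{(i)} for 1 ≤ i < ⌊j/2⌋. -/

import Mathlib

open MvPolynomial

noncomputable section

/-- The Hilbert function of the graded quotient `R/I`, where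
`R = K[x_1,...,x_n]`: the dimension of the image in `R/I` of the space of
degree-`i` homogeneous forms. -/
def hilb (n : ℕ) (K : Type*) [Field K] (I : Ideal (MvPolynomial (Fin n) K)) (i : ℕ) : ℕ :=
  Module.finrank K
    ((homogeneousSubmodule (Fin n) K i).map (Ideal.Quotient.mkₐ K I).toLinearMap)

/-- The socle `(0 : A_+)` of `A = R/I`: the elements killed by (the images of)
all the variables, equivalently by the irrelevant maximal ideal. -/
def socleSub (n : ℕ) (K : Type*) [Field K] (I : Ideal (MvPolynomial (Fin n) K)) :
    Submodule K (MvPolynomial (Fin n) K ⧸ I) :=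
  ⨅ k : Fin n, LinearMap.ker (LinearMap.mulLeft K (Ideal.Quotient.mk I (X k)))

/-- A homogeneous (graded) ideal: one containing each homogeneous component of
each of its elements. -/
def IdealHomog {n : ℕ} {K : Type*} [Field K] (I : Ideal (MvPolynomial (Fin n) K)) : Prop :=
  ∀ f ∈ I, ∀ d : ℕ, homogeneousComponent d f ∈ I

/-- `R/I` is a graded Artinian Gorenstein quotient of `R = K[x_1,...,x_n]`
of socle degree `j`: `I` is homogeneous, `R/I` is finite dimensional over `K`
with 1-dimensional socle, and `j` is the top nonzero degree. -/
def IsAG (n : ℕ) (K : Type*) [Field K] (I : Ideal (MvPolynomial (Fin n) K)) (j : ℕ) : Prop :=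
  IdealHomog I ∧ FiniteDimensional K (MvPolynomial (Fin n) K ⧸ I) ∧
    Module.finrank K (socleSub n K I) = 1 ∧
    hilb n K I j ≠ 0 ∧ ∀ i, j < i → hilb n K I i = 0

/-- Macaulay's bound `c^{(d)}`: writing `c = C(k_d,d) + ... + C(k_1,1)` with
`k_d > k_d-1 > ... > k_1 ≥ 0` (the `d`-th Macaulay expansion, computed greedily),
`c^{(d)} = C(k_d+1,d+1) + ... + C(k_1+1,2)`; by convention `0^{(d)} = 0`. -/
def macB : ℕ → ℕ → ℕ
  | _, 0 => 0
  | c, (d+1) =>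
    if c = 0 then 0 else
      let k := Nat.findGreatest (fun k => Nat.choose k (d+1) ≤ c) (c + d + 1)
      Nat.choose (k+1) (d+2) + macB (c - Nat.choose k (d+1)) d

/-- `(t_0, ..., t_m)` is an O-sequence: `t_0 = 1` and `t_{i+1} ≤ t_i^{(i)}`
for `1 ≤ i ≤ m-1`. -/
def IsOSeq (t : ℕ → ℕ) (m : ℕ) : Prop :=
  t 0 = 1 ∧ ∀ i, 1 ≤ i → i + 1 ≤ m → t (i + 1) ≤ macB (t i) i

/-- `ΔH_{≤ m}` is an O-sequence: the first differences `ΔH_i = h_i - h_{i-1}`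
(with `ΔH_0 = 1`) are nonnegative for `i ≤ m`, and `(ΔH_0, ..., ΔH_m)` is an
O-sequence. -/
def DeltaOSeq (h : ℕ → ℕ) (m : ℕ) : Prop :=
  (∀ i, 1 ≤ i → i ≤ m → h (i - 1) ≤ h i) ∧
    IsOSeq (fun i => if i = 0 then 1 else h i - h (i - 1)) m



/-! ### Basic facts about graded pieces -/

lemma finrank_hm (K : Type*) [Field K] (i : ℕ) :
    Module.finrank K (homogeneousSubmodule (Fin 4) K i) = (i + 3).choose 3 := by
  have hset : {d : Fin 4 →₀ ℕ | d.degree = i} =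
      ((Finset.finsuppAntidiag (Finset.univ : Finset (Fin 4)) i : Finset (Fin 4 →₀ ℕ)) :
        Set (Fin 4 →₀ ℕ)) := by
    ext d
    simp [Finset.mem_finsuppAntidiag, Finsupp.degree_eq_sum]
  have h1 : homogeneousSubmodule (Fin 4) K i = restrictSupport K {d : Fin 4 →₀ ℕ | d.degree = i} :=
    homogeneousSubmodule_eq_finsupp_supported (Fin 4) K i
  rw [h1, Module.finrank_eq_nat_card_basis (basisRestrictSupport K _), hset, Nat.card_coe_set_eq,
    Set.ncard_coe_finset, Finset.card_finsuppAntidiag_nat_eq_choose]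
  rw [Finset.card_univ, Fintype.card_fin, show 4 + i - 1 = i + 3 by omega]
  exact Nat.choose_symm_add

instance hm_fd (K : Type*) [Field K] (i : ℕ) :
    Module.Finite K (homogeneousSubmodule (Fin 4) K i) :=
  Module.Finite.iff_fg.mpr (homogeneousSubmodule_fg (Fin 4) K i)

lemma homComp_mul {K : Type*} [Field K] {e : ℕ} {l : MvPolynomial (Fin 4) K}
    (hl : l.IsHomogeneous e) (a : MvPolynomial (Fin 4) K) (n : ℕ) :
    homogeneousComponent (n + e) (a * l) = homogeneousComponent n a * l := by
  conv_lhs => rw [← sum_homogeneousComponent a, Finset.sum_mul, map_sum]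
  have : ∀ i, homogeneousComponent (n + e) (homogeneousComponent i a * l) =
      if i = n then homogeneousComponent n a * l else 0 := by
    intro i
    have hm := (homogeneousComponent_isHomogeneous i a).mul hl
    rw [homogeneousComponent_of_mem hm]
    by_cases h : i = n
    · subst h; simp
    · rw [if_neg h, if_neg (by omega)]
  simp only [this]
  rw [Finset.sum_ite_eq']
  split_ifs with h
  · rfl
  · rw [homogeneousComponent_eq_zero _ _ (by simpa using h)]
    simp

lemma homComp_self {K : Type*} [Field K] {e : ℕ} {l : MvPolynomial (Fin 4) K}
    (hl : l.IsHomogeneous e) : homogeneousComponent e l = l := by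
  rw [homogeneousComponent_of_mem hl]; simp

/-- Induction principle: forms of degree `n+1` are sums of products. -/
lemma hm_succ_induction {K : Type*} [Field K] {n : ℕ}
    {P : MvPolynomial (Fin 4) K → Prop}
    (hmul : ∀ g f : MvPolynomial (Fin 4) K, g.IsHomogeneous 1 → f.IsHomogeneous n → P (g * f))
    (hadd : ∀ f g, P f → P g → P (f + g))
    (f : MvPolynomial (Fin 4) K) (hf : f.IsHomogeneous (n + 1)) : P f := by
  have hf' : f ∈ homogeneousSubmodule (Fin 4) K (n + 1) := hf
  rw [← homogeneousSubmodule_one_pow, pow_succ', homogeneousSubmodule_one_pow] at hf'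
  exact Submodule.mul_induction_on hf' (fun g hg f hf => hmul g f hg hf) (fun x y => hadd x y)

/-- The degree `i` piece of `R/I`. -/
def Agr {K : Type*} [Field K] (I : Ideal (MvPolynomial (Fin 4) K)) (i : ℕ) :
    Submodule K (MvPolynomial (Fin 4) K ⧸ I) :=
  (homogeneousSubmodule (Fin 4) K i).map (Ideal.Quotient.mkₐ K I).toLinearMap

lemma hilb_eq {K : Type*} [Field K] (I : Ideal (MvPolynomial (Fin 4) K)) (i : ℕ) :
    hilb 4 K I i = Module.finrank K (Agr I i) := rfl

lemma mem_Agr {K : Type*} [Field K] {I : Ideal (MvPolynomial (Fin 4) K)} {i : ℕ}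
    {a : MvPolynomial (Fin 4) K ⧸ I} :
    a ∈ Agr I i ↔ ∃ f : MvPolynomial (Fin 4) K, f.IsHomogeneous i ∧ Ideal.Quotient.mk I f = a := by
  simp [Agr, Submodule.mem_map]

lemma mk_mem_Agr {K : Type*} [Field K] {I : Ideal (MvPolynomial (Fin 4) K)} {i : ℕ}
    {f : MvPolynomial (Fin 4) K} (hf : f.IsHomogeneous i) : Ideal.Quotient.mk I f ∈ Agr I i :=
  mem_Agr.mpr ⟨f, hf, rfl⟩

lemma Agr_mul {K : Type*} [Field K] {I : Ideal (MvPolynomial (Fin 4) K)} {i k : ℕ}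
    {a b : MvPolynomial (Fin 4) K ⧸ I} (ha : a ∈ Agr I i) (hb : b ∈ Agr I k) :
    a * b ∈ Agr I (i + k) := by
  obtain ⟨f, hf, rfl⟩ := mem_Agr.mp ha
  obtain ⟨g, hg, rfl⟩ := mem_Agr.mp hb
  rw [← map_mul]
  exact mk_mem_Agr (hf.mul hg)

lemma Agr_disj {K : Type*} [Field K] {I : Ideal (MvPolynomial (Fin 4) K)} (hI : IdealHomog I)
    {i k : ℕ} (hik : i ≠ k)
    {a : MvPolynomial (Fin 4) K ⧸ I} (ha : a ∈ Agr I i) (hb : a ∈ Agr I k) : a = 0 := by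
  obtain ⟨f, hf, rfl⟩ := mem_Agr.mp ha
  obtain ⟨g, hg, h⟩ := mem_Agr.mp hb
  rw [Ideal.Quotient.eq_zero_iff_mem]
  have h1 := hI _ (Ideal.Quotient.eq.mp h) i
  rw [map_sub, homComp_self hf, homogeneousComponent_of_mem hg, if_neg hik] at h1
  simpa using I.neg_mem h1

section gor
variable {K : Type*} [Field K] {I : Ideal (MvPolynomial (Fin 4) K)} {j : ℕ}

lemma Agr_top (hI : IsAG 4 K I j) {i : ℕ} (hi : j < i) {a : MvPolynomial (Fin 4) K ⧸ I}
    (ha : a ∈ Agr I i) : a = 0 := by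
  have := hI.2.1
  have h := hI.2.2.2.2 i hi
  rw [hilb_eq, Submodule.finrank_eq_zero] at h
  rw [h] at ha
  simpa using ha

lemma mem_socle {a : MvPolynomial (Fin 4) K ⧸ I} :
    a ∈ socleSub 4 K I ↔ ∀ k, Ideal.Quotient.mk I (X k) * a = 0 := by
  simp [socleSub, Submodule.mem_iInf]

lemma Agr_j (hI : IsAG 4 K I j) : Agr I j = socleSub 4 K I := by
  have := hI.2.1
  apply Submodule.eq_of_le_of_finrank_le
  · intro a ha
    rw [mem_socle]
    intro k
    exact Agr_top hI (i := 1 + j) (by omega) (Agr_mul (mk_mem_Agr (isHomogeneous_X K k)) ha)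
  · rw [hI.2.2.1]
    have := hI.2.2.2.1
    rw [hilb_eq] at this
    omega

lemma nondeg (hI : IsAG 4 K I j) : ∀ (n i : ℕ), i + n = j → ∀ a ∈ Agr I i, a ≠ 0 →
    ∃ b ∈ Agr I n, a * b ≠ 0 := by
  intro n
  induction n with
  | zero =>
    intro i hi a ha h0
    exact ⟨1, mem_Agr.mpr ⟨1, isHomogeneous_one _ _, by simp⟩, by simpa using h0⟩
  | succ n ih =>
    intro i hi a ha h0
    have hs : a ∉ socleSub 4 K I := by
      intro hs
      rw [← Agr_j hI] at hs
      exact h0 (Agr_disj hI.1 (by omega) ha hs)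
    rw [mem_socle] at hs
    push Not at hs
    obtain ⟨k, hk⟩ := hs
    have hX : Ideal.Quotient.mk I (X k) ∈ Agr I 1 := mk_mem_Agr (isHomogeneous_X K k)
    obtain ⟨b, hb, hab⟩ := ih (1 + i) (by omega) _ (Agr_mul hX ha) hk
    refine ⟨Ideal.Quotient.mk I (X k) * b, by rw [add_comm]; exact Agr_mul hX hb, ?_⟩
    intro h
    apply hab
    rw [← h]; ring

lemma exists_functional (hI : IsAG 4 K I j) :
    ∃ φ : (MvPolynomial (Fin 4) K ⧸ I) →ₗ[K] K, ∀ a ∈ Agr I j, φ a = 0 → a = 0 := by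
  have := hI.2.1
  have h1 : Module.finrank K (Agr I j) = 1 := by rw [Agr_j hI]; exact hI.2.2.1
  obtain ⟨v, hv, hspan⟩ := finrank_eq_one_iff'.mp h1
  have hv' : (v : MvPolynomial (Fin 4) K ⧸ I) ≠ 0 := by simpa using hv
  have : ¬ ∀ φ : Module.Dual K (MvPolynomial (Fin 4) K ⧸ I), φ v = 0 := by
    rwa [Module.forall_dual_apply_eq_zero_iff]
  push Not at this
  obtain ⟨φ, hφ⟩ := this
  refine ⟨φ, fun a ha h => ?_⟩
  obtain ⟨c, hc⟩ := hspan ⟨a, ha⟩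
  have hc' : c • (v : MvPolynomial (Fin 4) K ⧸ I) = a := congrArg Subtype.val hc
  rw [← hc', map_smul, smul_eq_mul] at h
  rcases mul_eq_zero.mp h with h | h
  · rw [← hc', h, zero_smul]
  · exact absurd h hφ

lemma finrank_range_flip {U W : Type*} [AddCommGroup U] [Module K U] [AddCommGroup W] [Module K W]
    [FiniteDimensional K U] [FiniteDimensional K W] (B : U →ₗ[K] W →ₗ[K] K) :
    Module.finrank K (LinearMap.range B.flip) = Module.finrank K (LinearMap.range B) := by
  have h : B.flip = B.dualMap ∘ₗ (Module.Dual.eval K W) := by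
    ext; simp
  rw [h, LinearMap.range_comp, LinearMap.range_eq_top.mpr, Submodule.map_top]
  · exact LinearMap.finrank_range_dualMap_eq_finrank_range B
  · exact (Module.evalEquiv K W).surjective

lemma finrank_range_of_ker {U V W : Type*} [AddCommGroup U] [Module K U] [AddCommGroup W]
    [Module K W] [AddCommGroup V] [Module K V]
    [FiniteDimensional K U] (f : U →ₗ[K] V) (g : U →ₗ[K] W)
    (h : LinearMap.ker f = LinearMap.ker g) :
    Module.finrank K (LinearMap.range f) = Module.finrank K (LinearMap.range g) := by
  have h1 := LinearMap.finrank_range_add_finrank_ker f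
  have h2 := LinearMap.finrank_range_add_finrank_ker g
  rw [h] at h1
  omega

lemma rank_symm (hI : IsAG 4 K I j) {a b e : ℕ} (habe : a + b + e = j)
    {g : MvPolynomial (Fin 4) K ⧸ I} (hg : g ∈ Agr I e) :
    Module.finrank K ((Agr I a).map (LinearMap.mulLeft K g)) =
      Module.finrank K ((Agr I b).map (LinearMap.mulLeft K g)) := by
  have := hI.2.1
  obtain ⟨φ, hφ⟩ := exists_functional hI
  let B : Agr I a →ₗ[K] Agr I b →ₗ[K] K :=
    ((LinearMap.mul K (MvPolynomial (Fin 4) K ⧸ I) ∘ₗ LinearMap.mulLeft K g).compr₂ φ).domRestrict₁₂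
      (Agr I a) (Agr I b)
  have hB : ∀ x y, B x y = φ (g * x * y) := fun x y => rfl
  have k1 : LinearMap.ker B = LinearMap.ker ((LinearMap.mulLeft K g).domRestrict (Agr I a)) := by
    ext x
    simp only [LinearMap.mem_ker, LinearMap.domRestrict_apply, LinearMap.mulLeft_apply]
    constructor
    · intro h
      by_contra h0
      obtain ⟨y, hy, hxy⟩ := nondeg hI b (e + a) (by omega) _ (Agr_mul hg x.2) h0
      apply hxy
      apply hφ
      · have := Agr_mul (Agr_mul hg x.2) hy
        rwa [show e + a + b = j by omega] at this
      · have := hB x ⟨y, hy⟩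
        rw [h] at this
        simpa using this.symm
    · intro h
      ext y
      rw [hB, h]; simp
  have k2 : LinearMap.ker B.flip = LinearMap.ker ((LinearMap.mulLeft K g).domRestrict (Agr I b)) := by
    ext y
    simp only [LinearMap.mem_ker, LinearMap.domRestrict_apply, LinearMap.mulLeft_apply]
    constructor
    · intro h
      by_contra h0
      obtain ⟨x, hx, hxy⟩ := nondeg hI a (e + b) (by omega) _ (Agr_mul hg y.2) h0
      apply hxy
      apply hφ
      · have := Agr_mul (Agr_mul hg y.2) hx
        rwa [show e + b + a = j by omega] at this
      · have h2 := hB ⟨x, hx⟩ y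
        have h3 : B ⟨x, hx⟩ y = 0 := by
          rw [← LinearMap.flip_apply, h]; simp
        rw [h3] at h2
        rw [mul_right_comm]
        simpa using h2.symm
    · intro h
      ext x
      rw [LinearMap.flip_apply, hB, mul_right_comm, h]; simp
  have r1 := finrank_range_of_ker _ _ k1
  have r2 := finrank_range_of_ker _ _ k2
  rw [finrank_range_flip, r1] at r2
  rwa [LinearMap.range_domRestrict, LinearMap.range_domRestrict] at r2

lemma hilb_symm (hI : IsAG 4 K I j) {a b : ℕ} (hab : a + b = j) :
    hilb 4 K I a = hilb 4 K I b := by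
  have h := rank_symm hI (a := a) (b := b) (e := 0) (by omega) (g := 1)
    (mem_Agr.mpr ⟨1, isHomogeneous_one _ _, by simp⟩)
  have h1 : LinearMap.mulLeft K (1 : MvPolynomial (Fin 4) K ⧸ I) = LinearMap.id := by
    ext; simp
  rw [h1, Submodule.map_id, Submodule.map_id] at h
  exact h

/-- `I` restricts to everything in degree `i` on some line. -/
def LineP (I : Ideal (MvPolynomial (Fin 4) K)) (i : ℕ) : Prop :=
  ∃ l l' : MvPolynomial (Fin 4) K, l.IsHomogeneous 1 ∧ l'.IsHomogeneous 1 ∧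
    ∀ f : MvPolynomial (Fin 4) K, f.IsHomogeneous i → f ∈ I ⊔ Ideal.span {l, l'}

lemma LineP_step {l l' : MvPolynomial (Fin 4) K} {i k : ℕ} (hik : i ≤ k)
    (h : ∀ f : MvPolynomial (Fin 4) K, f.IsHomogeneous i → f ∈ I ⊔ Ideal.span {l, l'}) :
    ∀ f : MvPolynomial (Fin 4) K, f.IsHomogeneous k → f ∈ I ⊔ Ideal.span {l, l'} := by
  induction k, hik using Nat.le_induction with
  | base => exact h
  | succ k hk ih =>
    exact hm_succ_induction (fun g f _ hf => Ideal.mul_mem_left _ _ (ih f hf))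
      (fun f g => Ideal.add_mem _)

lemma LineP_mono {i k : ℕ} (hik : i ≤ k) (h : LineP I i) : LineP I k := by
  obtain ⟨l, l', hl, hl', h⟩ := h
  exact ⟨l, l', hl, hl', LineP_step hik h⟩

lemma c_step (hI : IsAG 4 K I j) {l l' : MvPolynomial (Fin 4) K} (hl : l.IsHomogeneous 1)
    (hl' : l'.IsHomogeneous 1) {k : ℕ}
    (h : ∀ f : MvPolynomial (Fin 4) K, f.IsHomogeneous (k + 2) → f ∈ I ⊔ Ideal.span {l, l'}) :
    hilb 4 K I (k + 2) + Module.finrank K ((Agr I k).map (LinearMap.mulLeft K (Ideal.Quotient.mk I l)))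
     ≤ hilb 4 K I (k + 1) +
      Module.finrank K ((Agr I (k + 1)).map (LinearMap.mulLeft K (Ideal.Quotient.mk I l))) := by
  have := hI.2.1
  set L := LinearMap.mulLeft K (Ideal.Quotient.mk I l) with hL
  set L' := LinearMap.mulLeft K (Ideal.Quotient.mk I l') with hL'
  have h1 : Agr I (k + 2) ≤ (Agr I (k + 1)).map L ⊔ (Agr I (k + 1)).map L' := by
    intro a ha
    obtain ⟨f, hf, rfl⟩ := mem_Agr.mp ha
    obtain ⟨g, hg, s, hs, hgs⟩ := Submodule.mem_sup.mp (h f hf)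
    obtain ⟨u, v, huv⟩ := Ideal.mem_span_pair.mp hs
    have hc := congrArg (homogeneousComponent (k + 1 + 1)) hgs
    rw [← huv, map_add, map_add, homComp_mul hl, homComp_mul hl', homComp_self hf] at hc
    have hz : Ideal.Quotient.mk I (homogeneousComponent (k + 1 + 1) g) = 0 :=
      Ideal.Quotient.eq_zero_iff_mem.mpr (hI.1 g hg _)
    rw [← hc, map_add, hz, zero_add, map_add]
    refine Submodule.add_mem_sup ?_ ?_
    · exact ⟨_, mk_mem_Agr (homogeneousComponent_isHomogeneous (k+1) u), by
        simp [hL, mul_comm]⟩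
    · exact ⟨_, mk_mem_Agr (homogeneousComponent_isHomogeneous (k+1) v), by
        simp [hL', mul_comm]⟩
  have h3 : ((Agr I k).map L).map L' ≤ (Agr I (k + 1)).map L ⊓ (Agr I (k + 1)).map L' := by
    rintro _ ⟨_, ⟨a, ha, rfl⟩, rfl⟩
    refine ⟨⟨L' a, ?_, ?_⟩, ⟨L a, ?_, rfl⟩⟩
    · have := Agr_mul (mk_mem_Agr (I := I) hl') ha
      rwa [add_comm] at this
    · simp only [hL, hL', LinearMap.mulLeft_apply]; ring
    · have := Agr_mul (mk_mem_Agr (I := I) hl) ha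
      rwa [add_comm] at this
  have e1 := Submodule.finrank_mono h1
  have e2 := Submodule.finrank_sup_add_finrank_inf_eq ((Agr I (k + 1)).map L) ((Agr I (k + 1)).map L')
  have e3 := Submodule.finrank_mono h3
  -- kernel of `L'` restricted to `Agr (k+1)` versus to its subspace
  have hle : (Agr I k).map L ≤ Agr I (k + 1) := by
    rintro _ ⟨a, ha, rfl⟩
    have := Agr_mul (mk_mem_Agr (I := I) hl) ha
    rwa [add_comm] at this
  have f1 := LinearMap.finrank_range_add_finrank_ker (L'.domRestrict (Agr I (k + 1)))
  have f2 := LinearMap.finrank_range_add_finrank_ker (L'.domRestrict ((Agr I k).map L))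
  have f3 : Module.finrank K (LinearMap.ker (L'.domRestrict ((Agr I k).map L))) ≤
      Module.finrank K (LinearMap.ker (L'.domRestrict (Agr I (k + 1)))) := by
    let ι : LinearMap.ker (L'.domRestrict ((Agr I k).map L)) →ₗ[K]
        LinearMap.ker (L'.domRestrict (Agr I (k + 1))) :=
      (Submodule.inclusion hle).restrict (fun x hx => by
        simpa using hx)
    apply LinearMap.finrank_le_finrank_of_injective (f := ι)
    intro x y hxy
    have := congrArg (fun z : LinearMap.ker (L'.domRestrict (Agr I (k + 1))) => ((z : Agr I (k+1)) : MvPolynomial (Fin 4) K ⧸ I)) hxy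
    ext
    simpa [ι] using this
  rw [LinearMap.range_domRestrict] at f1 f2
  rw [hilb_eq, hilb_eq]
  omega

lemma LineP_delta (hI : IsAG 4 K I j) {i : ℕ} (h2 : 2 ≤ i) (hij : i ≤ j / 2) (h : LineP I i) :
    hilb 4 K I (i - 1) ≤ hilb 4 K I i ∧
      hilb 4 K I i + hilb 4 K I (i - 2) ≤ 2 * hilb 4 K I (i - 1) := by
  obtain ⟨l, l', hl, hl', h⟩ := h
  set ρ : ℕ → ℕ := fun k =>
    Module.finrank K ((Agr I k).map (LinearMap.mulLeft K (Ideal.Quotient.mk I l))) with hρ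
  have step : ∀ k, i ≤ k + 2 → hilb 4 K I (k + 2) + ρ k ≤ hilb 4 K I (k + 1) + ρ (k + 1) :=
    fun k hk => c_step hI hl hl' (LineP_step hk h)
  have sy : ∀ a b, a + b + 1 = j → ρ a = ρ b := fun a b hab =>
    rank_symm hI hab (mk_mem_Agr hl)
  have sh : ∀ a b, a + b = j → hilb 4 K I a = hilb 4 K I b := fun a b hab => hilb_symm hI hab
  have chain : ∀ n, hilb 4 K I (i + n) + ρ (i - 1) ≤ hilb 4 K I i + ρ (i - 1 + n) := by
    intro n
    induction n with
    | zero => simp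
    | succ n ih =>
      have := step (i - 1 + n) (by omega)
      rw [show i - 1 + n + 2 = i + (n + 1) by omega, show i - 1 + n + 1 = i + n by omega] at this
      rw [show i - 1 + (n + 1) = i + n by omega]
      omega
  constructor
  · have c := chain (j + 1 - 2 * i)
    rw [show i + (j + 1 - 2 * i) = j + 1 - i by omega, show i - 1 + (j + 1 - 2 * i) = j - i by omega,
      sh (j + 1 - i) (i - 1) (by omega), sy (j - i) (i - 1) (by omega)] at c
    omega
  · have s1 := step (i - 2) (by omega)
    rw [show i - 2 + 2 = i by omega, show i - 2 + 1 = i - 1 by omega] at s1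
    have s2 := step (j - i) (by omega)
    rw [sh (j - i + 2) (i - 2) (by omega), sh (j - i + 1) (i - 1) (by omega),
      sy (j - i) (i - 1) (by omega), sy (j - i + 1) (i - 2) (by omega)] at s2
    omega

end gor


/-! ### Linear forms -/

section lin
variable {K : Type*} [Field K]

lemma lin_map {Q : Type*} [CommRing Q] [Algebra K Q] (ψ : MvPolynomial (Fin 4) K →ₐ[K] Q)
    (p r : Fin 4 → K) (S T : Q) (h : ∀ k, ψ (X k) = p k • S + r k • T)
    (g : MvPolynomial (Fin 4) K) (hg : g.IsHomogeneous 1) :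
    ψ g = eval p g • S + eval r g • T := by
  have hg' : g ∈ homogeneousSubmodule (Fin 4) K 1 := hg
  rw [homogeneousSubmodule_one_eq_span_X] at hg'
  induction hg' using Submodule.span_induction with
  | mem x hx => obtain ⟨k, rfl⟩ := hx; simpa using h k
  | zero => simp
  | add x y hx hy ihx ihy =>
    rw [← homogeneousSubmodule_one_eq_span_X] at hx hy
    rw [map_add, ihx hx, ihy hy]; simp only [map_add, add_smul]; abel
  | smul c x hx ih =>
    rw [← homogeneousSubmodule_one_eq_span_X] at hx
    rw [map_smul, ih hx]; simp [smul_smul]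

lemma lin_exists (m : MvPolynomial (Fin 4) K) (hm : m.IsHomogeneous 1) :
    ∃ a : Fin 4 → K, m = ∑ k, C (a k) * X k := by
  have hg' : m ∈ homogeneousSubmodule (Fin 4) K 1 := hm
  rw [homogeneousSubmodule_one_eq_span_X] at hg'
  obtain ⟨c, hc⟩ := (Submodule.mem_span_range_iff_exists_fun K).mp hg'
  exact ⟨c, by rw [← hc]; simp [smul_eq_C_mul]⟩

lemma lin_theta (m : MvPolynomial (Fin 4) K) (hm : m.IsHomogeneous 1) (h0 : m ≠ 0) :
    ∃ θ : MvPolynomial (Fin 4) K →ₐ[K] MvPolynomial (Fin 4) K, ∀ h, θ h = 0 ↔ m ∣ h := by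
  obtain ⟨a, ha⟩ := lin_exists m hm
  have : ∃ k, a k ≠ 0 := by
    by_contra hc
    push Not at hc
    apply h0
    rw [ha]; simp [hc]
  obtain ⟨k₀, hk₀⟩ := this
  let θ : MvPolynomial (Fin 4) K →ₐ[K] MvPolynomial (Fin 4) K :=
    aeval (fun k => X k - (if k = k₀ then C (a k₀)⁻¹ * m else 0))
  have hθX : ∀ k, θ (X k) = X k - (if k = k₀ then C (a k₀)⁻¹ * m else 0) := fun k => by simp [θ]
  have hθC : ∀ c, θ (C c) = C c := fun c => by simp [θ, algebraMap_eq]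
  have hθm : θ m = 0 := by
    have : θ m = ∑ k, C (a k) * (X k - (if k = k₀ then C (a k₀)⁻¹ * m else 0)) := by
      conv_lhs => rw [ha]
      simp only [map_sum, map_mul, hθX, hθC]
    rw [this]
    simp only [mul_sub, Finset.sum_sub_distrib, ← ha, mul_ite, mul_zero, Finset.sum_ite_eq',
      Finset.mem_univ, if_true]
    rw [← mul_assoc, ← C_mul, mul_inv_cancel₀ hk₀]; simp
  have hcomp : (Ideal.Quotient.mkₐ K (Ideal.span {m})).comp θ = Ideal.Quotient.mkₐ K (Ideal.span {m}) := by
    apply MvPolynomial.algHom_ext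
    intro k
    simp only [AlgHom.comp_apply, hθX, map_sub]
    rw [sub_eq_self]
    split_ifs
    · simp only [Ideal.Quotient.mkₐ_eq_mk]
      rw [Ideal.Quotient.eq_zero_iff_mem]
      exact Ideal.mul_mem_left _ _ (Ideal.mem_span_singleton_self m)
    · simp
  refine ⟨θ, fun h => ⟨fun hh => ?_, ?_⟩⟩
  · have := DFunLike.congr_fun hcomp h
    simp only [AlgHom.comp_apply, hh, map_zero] at this
    rw [← Ideal.mem_span_singleton, ← Ideal.Quotient.eq_zero_iff_mem]
    exact this.symm
  · rintro ⟨c, rfl⟩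
    rw [map_mul, hθm, zero_mul]

lemma lin_prime {m f g : MvPolynomial (Fin 4) K} (hm : m.IsHomogeneous 1) (h0 : m ≠ 0)
    (h : m ∣ f * g) : m ∣ f ∨ m ∣ g := by
  obtain ⟨θ, hθ⟩ := lin_theta m hm h0
  rw [← hθ, map_mul, mul_eq_zero, hθ, hθ] at h
  exact h

lemma lin_point [Infinite K] {m h : MvPolynomial (Fin 4) K} (hm : m.IsHomogeneous 1) (h0 : m ≠ 0)
    (hh : ¬ m ∣ h) : ∃ q : Fin 4 → K, eval q m = 0 ∧ eval q h ≠ 0 := by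
  obtain ⟨θ, hθ⟩ := lin_theta m hm h0
  have h1 : θ h ≠ 0 := fun h2 => hh ((hθ h).mp h2)
  have : ∃ a, eval a (θ h) ≠ 0 := by
    by_contra hc
    push Not at hc
    exact h1 (MvPolynomial.funext (fun x => by simpa using hc x))
  obtain ⟨a, ha⟩ := this
  have key : ∀ f, eval (fun k => eval a (θ (X k))) f = eval a (θ f) := by
    intro f
    have : (aeval (R := K) (fun k => eval a (θ (X k)))) = (aeval (R := K) a).comp θ := by
      apply MvPolynomial.algHom_ext
      intro k
      simp [aeval_eq_eval]
    have := DFunLike.congr_fun this f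
    simpa [aeval_eq_eval] using this
  exact ⟨_, by rw [key, (hθ m).mpr dvd_rfl, map_zero], by rwa [key]⟩

lemma hom_factor {n : ℕ} {q b : MvPolynomial (Fin 4) K} (hq : q.IsHomogeneous (n + 1))
    (hb : b.IsHomogeneous 1) (h : b ∣ q) :
    ∃ m : MvPolynomial (Fin 4) K, m.IsHomogeneous n ∧ q = b * m := by
  obtain ⟨c, hc⟩ := h
  refine ⟨homogeneousComponent n c, homogeneousComponent_isHomogeneous n c, ?_⟩
  rw [mul_comm, ← homComp_mul hb, mul_comm, ← hc, homComp_self hq]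

end lin

/-! ### Quadrics on lines -/

section quad
universe u
variable {K : Type u} [Field K]

lemma quad_polar (p : Fin 4 → K) (f : MvPolynomial (Fin 4) K) (hf : f.IsHomogeneous 2) :
    ∃ b : MvPolynomial (Fin 4) K, b.IsHomogeneous 1 ∧ eval p b = 2 * eval p f ∧
      ∀ (Q : Type u) [CommRing Q] [Algebra K Q] (ψ : MvPolynomial (Fin 4) K →ₐ[K] Q)
        (r : Fin 4 → K) (S T : Q), (∀ k, ψ (X k) = p k • S + r k • T) →
        ψ f = eval p f • S ^ 2 + eval r b • (S * T) + eval r f • T ^ 2 := by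
  revert f
  change ∀ f : MvPolynomial (Fin 4) K, f.IsHomogeneous (1 + 1) → _
  refine hm_succ_induction ?_ ?_
  · intro g h hg hh
    refine ⟨C (eval p g) * h + C (eval p h) * g, (hh.C_mul _).add (hg.C_mul _), ?_, ?_⟩
    · simp; ring
    · intro Q _ _ ψ r S T hX
      rw [map_mul, lin_map ψ p r S T hX g hg, lin_map ψ p r S T hX h hh]
      simp only [Algebra.smul_def, map_add, map_mul, eval_C]
      ring
  · rintro f g ⟨b, hb, hbp, h1⟩ ⟨c, hc, hcp, h2⟩
    refine ⟨b + c, hb.add hc, ?_, ?_⟩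
    · simp [hbp, hcp]; ring
    · intro Q _ _ ψ r S T hX
      rw [map_add, h1 Q ψ r S T hX, h2 Q ψ r S T hX]
      simp only [Algebra.smul_def, map_add]
      ring

lemma line_forms (p r : Fin 4 → K) {a b' : Fin 4} (hb' : p a * r b' ≠ p b' * r a) :
    ∃ l l' s t : MvPolynomial (Fin 4) K, l.IsHomogeneous 1 ∧ l'.IsHomogeneous 1 ∧
      ∀ I : Ideal (MvPolynomial (Fin 4) K), ∀ k,
        Ideal.Quotient.mkₐ K (I ⊔ Ideal.span {l, l'}) (X k) =
          p k • Ideal.Quotient.mkₐ K (I ⊔ Ideal.span {l, l'}) s +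
          r k • Ideal.Quotient.mkₐ K (I ⊔ Ideal.span {l, l'}) t := by
  have hab : a ≠ b' := by
    rintro rfl; exact hb' rfl
  set D := p a * r b' - p b' * r a with hDdef
  have hD0 : D ≠ 0 := sub_ne_zero.mpr hb'
  have hcd : ∃ c d : Fin 4, ∀ k, k = a ∨ k = b' ∨ k = c ∨ k = d := by
    clear * - hab
    revert a b'
    decide
  obtain ⟨c, d, hk⟩ := hcd
  let s : MvPolynomial (Fin 4) K := C D⁻¹ * (C (r b') * X a - C (r a) * X b')
  let t : MvPolynomial (Fin 4) K := C D⁻¹ * (C (p a) * X b' - C (p b') * X a)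
  have hs : s.IsHomogeneous 1 :=
    ((isHomogeneous_C_mul_X _ _).sub (isHomogeneous_C_mul_X _ _)).C_mul _
  have ht : t.IsHomogeneous 1 :=
    ((isHomogeneous_C_mul_X _ _).sub (isHomogeneous_C_mul_X _ _)).C_mul _
  let L : Fin 4 → MvPolynomial (Fin 4) K := fun k => X k - C (p k) * s - C (r k) * t
  have hL : ∀ k, (L k).IsHomogeneous 1 := fun k =>
    ((isHomogeneous_X K k).sub (hs.C_mul _)).sub (ht.C_mul _)
  have hCD : C D * C D⁻¹ = (1 : MvPolynomial (Fin 4) K) := by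
    rw [← C_mul, mul_inv_cancel₀ hD0, C_1]
  have hCD' : (C D : MvPolynomial (Fin 4) K) = C (p a) * C (r b') - C (p b') * C (r a) := by
    simp [hDdef]
  have hLa : L a = 0 := by
    simp only [L, s, t]
    linear_combination (-X a) * hCD + C D⁻¹ * X a * hCD'
  have hLb : L b' = 0 := by
    simp only [L, s, t]
    linear_combination (-X b') * hCD + C D⁻¹ * X b' * hCD'
  refine ⟨L c, L d, s, t, hL c, hL d, fun I => ?_⟩
  set J := I ⊔ Ideal.span {L c, L d} with hJ
  have hLJ : ∀ k, L k ∈ J := by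
    intro k
    rcases hk k with rfl | rfl | rfl | rfl
    · rw [hLa]; exact J.zero_mem
    · rw [hLb]; exact J.zero_mem
    · exact Ideal.mem_sup_right (Ideal.subset_span (by simp))
    · exact Ideal.mem_sup_right (Ideal.subset_span (by simp))
  let ψ := Ideal.Quotient.mkₐ K J
  intro k
  change ψ (X k) = p k • ψ s + r k • ψ t
  have h0 : ψ (L k) = 0 := Ideal.Quotient.eq_zero_iff_mem.mpr (hLJ k)
  have h1 : X k = L k + (p k • s + r k • t) := by
    simp only [L, smul_eq_C_mul]; ring
  rw [h1, map_add, h0, zero_add, map_add, map_smul, map_smul]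

lemma res_zero {I : Ideal (MvPolynomial (Fin 4) K)} (hP : ¬ LineP I 3) (p : Fin 4 → K)
    {q₁ q b₁ b : MvPolynomial (Fin 4) K} (hq₁ : q₁ ∈ I) (hq : q ∈ I)
    (hp1 : eval p q₁ = 1) (hp : eval p q = 0)
    (hbh : b.IsHomogeneous 1) (hbp : eval p b = 2 * eval p q)
    (h₁ : ∀ (Q : Type u) [CommRing Q] [Algebra K Q] (ψ : MvPolynomial (Fin 4) K →ₐ[K] Q)
        (r : Fin 4 → K) (S T : Q), (∀ k, ψ (X k) = p k • S + r k • T) →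
        ψ q₁ = eval p q₁ • S ^ 2 + eval r b₁ • (S * T) + eval r q₁ • T ^ 2)
    (h : ∀ (Q : Type u) [CommRing Q] [Algebra K Q] (ψ : MvPolynomial (Fin 4) K →ₐ[K] Q)
        (r : Fin 4 → K) (S T : Q), (∀ k, ψ (X k) = p k • S + r k • T) →
        ψ q = eval p q • S ^ 2 + eval r b • (S * T) + eval r q • T ^ 2)
    (r : Fin 4 → K) :
    (eval r q) ^ 2 - eval r b₁ * eval r b * eval r q + eval r q₁ * (eval r b) ^ 2 = 0 := by
  by_contra hD
  -- `p ≠ 0`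
  have hpa : ∃ a, p a ≠ 0 := by
    by_contra hc
    push Not at hc
    have hp0 : p = 0 := funext hc
    have := h₁ K (aeval p) 0 0 0 (fun k => by simp [hp0])
    simp [aeval_eq_eval, hp1] at this
  obtain ⟨a, ha⟩ := hpa
  by_cases hr : ∀ k, p a * r k = p k * r a
  · -- `r` is a multiple of `p`
    apply hD
    have hX : ∀ k, (aeval r : MvPolynomial (Fin 4) K →ₐ[K] K) (X k) =
        p k • (r a / p a) + (0 : Fin 4 → K) k • (0 : K) := by
      intro k
      simp only [aeval_X, smul_eq_mul, Pi.zero_apply, mul_zero, add_zero]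
      field_simp
      rw [mul_comm, hr k]
    have e1 := h K (aeval r) 0 _ _ hX
    have e2 := lin_map (aeval r) p 0 _ _ hX b hbh
    have e1' : eval r q = 0 := by simpa [aeval_eq_eval, hp] using e1
    have e2' : eval r b = 0 := by simpa [aeval_eq_eval, hbp, hp] using e2
    rw [e1', e2']; ring
  · push Not at hr
    obtain ⟨b', hb'⟩ := hr
    obtain ⟨l, l', s, t, hl, hl', hX⟩ := line_forms p r hb'
    refine hP ⟨l, l', hl, hl', ?_⟩
    specialize hX I
    set J := I ⊔ Ideal.span {l, l'} with hJ
    set ψ := Ideal.Quotient.mkₐ K J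
    have E1 := h₁ _ ψ r _ _ hX
    have E2 := h _ ψ r _ _ hX
    have z1 : ψ q₁ = 0 := Ideal.Quotient.eq_zero_iff_mem.mpr (Ideal.mem_sup_left hq₁)
    have z2 : ψ q = 0 := Ideal.Quotient.eq_zero_iff_mem.mpr (Ideal.mem_sup_left hq)
    rw [z1, hp1] at E1
    rw [z2, hp] at E2
    simp only [Algebra.smul_def, map_one, map_zero, one_mul, zero_mul, zero_add] at E1 E2
    set S := ψ s
    set T := ψ t
    set ι := algebraMap K (MvPolynomial (Fin 4) K ⧸ J)
    set D2 := (eval r q) ^ 2 - eval r b₁ * eval r b * eval r q + eval r q₁ * (eval r b) ^ 2 with hD2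
    have hinv : ι D2⁻¹ * ι D2 = 1 := by rw [← map_mul, inv_mul_cancel₀ hD, map_one]
    have hιD : ι D2 = (ι (eval r q)) ^ 2 - ι (eval r b₁) * ι (eval r b) * ι (eval r q)
        + ι (eval r q₁) * (ι (eval r b)) ^ 2 := by simp [hD2]
    set β := ι (eval r b)
    set γ := ι (eval r q)
    set B := ι (eval r b₁)
    set Γ := ι (eval r q₁)
    have T3' : ι D2 * T ^ 3 = 0 := by
      rw [hιD]
      linear_combination (- γ * T + B * β * T + β * S) * E2 - β ^ 2 * T * E1
    have ST2' : ι D2 * (S * T ^ 2) = 0 := by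
      rw [hιD]
      linear_combination (-γ * S - β * Γ * T) * E2 + γ * β * T * E1
    have T3 : T ^ 3 = 0 := by
      have := congrArg (fun x => ι D2⁻¹ * x) T3'
      simpa [← mul_assoc, hinv] using this
    have ST2 : S * T ^ 2 = 0 := by
      have := congrArg (fun x => ι D2⁻¹ * x) ST2'
      simpa [← mul_assoc, hinv] using this
    have S2T : S ^ 2 * T = 0 := by
      linear_combination - T * E1 - B * ST2 - Γ * T3
    have S3 : S ^ 3 = 0 := by
      linear_combination - S * E1 - B * S2T - Γ * ST2
    have hall : ∀ f : MvPolynomial (Fin 4) K, f.IsHomogeneous (2 + 1) → ψ f = 0 := by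
      refine hm_succ_induction ?_ ?_
      · intro g f hg hf
        obtain ⟨b₂, -, -, h₂⟩ := quad_polar p f hf
        rw [map_mul, h₂ _ ψ r _ _ hX, lin_map ψ p r _ _ hX g hg]
        simp only [Algebra.smul_def]
        change (ι _ * S + ι _ * T) * (ι _ * S ^ 2 + ι _ * (S * T) + ι _ * T ^ 2) = 0
        linear_combination (ι (eval p g) * ι (eval p f)) * S3
          + (ι (eval p g) * ι (eval r b₂) + ι (eval r g) * ι (eval p f)) * S2T
          + (ι (eval p g) * ι (eval r f) + ι (eval r g) * ι (eval r b₂)) * ST2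
          + ι (eval r g) * ι (eval r f) * T3
      · intro f g hf hg
        rw [map_add, hf, hg, add_zero]
    intro f hf
    exact Ideal.Quotient.eq_zero_iff_mem.mp (hall f hf)

end quad


/-! ### The common factor of the net of quadrics -/

section main
universe u
variable {K : Type u} [Field K]

lemma finrank_map_add_inf_ker {U V : Type*} [AddCommGroup U] [Module K U] [AddCommGroup V]
    [Module K V] (M : Submodule K U) [Module.Finite K M] (f : U →ₗ[K] V) :
    Module.finrank K (M.map f) + Module.finrank K (M ⊓ LinearMap.ker f : Submodule K U) =
      Module.finrank K M := by
  have h := LinearMap.finrank_range_add_finrank_ker (f.domRestrict M)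
  rw [LinearMap.range_domRestrict] at h
  have h2 : LinearMap.ker (f.domRestrict M) = (LinearMap.ker f).comap M.subtype := by
    ext; simp
  rw [h2, ← Submodule.finrank_map_subtype_eq, Submodule.map_comap_subtype] at h
  exact h

/-- The degree `i` part of the ideal. -/
def Igr (I : Ideal (MvPolynomial (Fin 4) K)) (i : ℕ) : Submodule K (MvPolynomial (Fin 4) K) :=
  homogeneousSubmodule (Fin 4) K i ⊓ I.restrictScalars K

lemma mem_Igr {I : Ideal (MvPolynomial (Fin 4) K)} {i : ℕ} {f : MvPolynomial (Fin 4) K} :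
    f ∈ Igr I i ↔ f.IsHomogeneous i ∧ f ∈ I := by
  simp [Igr]

instance Igr_fd (I : Ideal (MvPolynomial (Fin 4) K)) (i : ℕ) : Module.Finite K (Igr I i) :=
  Submodule.finiteDimensional_inf_left _ _

lemma finrank_Igr (I : Ideal (MvPolynomial (Fin 4) K)) (i : ℕ) :
    hilb 4 K I i + Module.finrank K (Igr I i) = (i + 3).choose 3 := by
  have h := finrank_map_add_inf_ker (homogeneousSubmodule (Fin 4) K i)
    (Ideal.Quotient.mkₐ K I).toLinearMap
  have hk : LinearMap.ker (Ideal.Quotient.mkₐ K I).toLinearMap = I.restrictScalars K := by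
    ext f
    simp [Ideal.Quotient.eq_zero_iff_mem]
  rw [hk, finrank_hm] at h
  exact h

/-- `(I : m)` in degree `n`. -/
def Wgr (I : Ideal (MvPolynomial (Fin 4) K)) (m : MvPolynomial (Fin 4) K) (n : ℕ) :
    Submodule K (MvPolynomial (Fin 4) K) :=
  homogeneousSubmodule (Fin 4) K n ⊓ (I.restrictScalars K).comap (LinearMap.mulLeft K m)

lemma mem_Wgr {I : Ideal (MvPolynomial (Fin 4) K)} {m : MvPolynomial (Fin 4) K} {n : ℕ}
    {f : MvPolynomial (Fin 4) K} : f ∈ Wgr I m n ↔ f.IsHomogeneous n ∧ m * f ∈ I := by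
  simp [Wgr]

instance Wgr_fd (I : Ideal (MvPolynomial (Fin 4) K)) (m : MvPolynomial (Fin 4) K) (n : ℕ) :
    Module.Finite K (Wgr I m n) :=
  Submodule.finiteDimensional_inf_left _ _

lemma finrank_Wgr {I : Ideal (MvPolynomial (Fin 4) K)} {m : MvPolynomial (Fin 4) K} {n : ℕ}
    (hm : m.IsHomogeneous 1) (h0 : m ≠ 0)
    (hdiv : ∀ f ∈ I, f.IsHomogeneous (n + 1) → m ∣ f) :
    Module.finrank K (Wgr I m n) = Module.finrank K (Igr I (n + 1)) := by
  have h : Igr I (n + 1) = (Wgr I m n).map (LinearMap.mulLeft K m) := by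
    ext f
    rw [mem_Igr, Submodule.mem_map]
    constructor
    · rintro ⟨hf, hfI⟩
      obtain ⟨g, hg, rfl⟩ := hom_factor hf hm (hdiv f hfI hf)
      exact ⟨g, mem_Wgr.mpr ⟨hg, hfI⟩, rfl⟩
    · rintro ⟨g, hg, rfl⟩
      rw [mem_Wgr] at hg
      exact ⟨by rw [add_comm]; exact hm.mul hg.1, hg.2⟩
  have hk : LinearMap.ker (LinearMap.mulLeft K m) = ⊥ := by
    rw [LinearMap.ker_eq_bot']
    intro x hx
    simpa [h0] using hx
  have := finrank_map_add_inf_ker (Wgr I m n) (LinearMap.mulLeft K m)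
  rw [hk, inf_bot_eq, finrank_bot, ← h] at this
  omega

lemma common_factor [Infinite K] {I : Ideal (MvPolynomial (Fin 4) K)} (hP : ¬ LineP I 3)
    (hdim : 2 ≤ Module.finrank K (Igr I 2)) :
    ∃ m : MvPolynomial (Fin 4) K, m.IsHomogeneous 1 ∧ m ≠ 0 ∧
      ∀ q ∈ I, q.IsHomogeneous 2 → m ∣ q := by
  have : ∃ q ∈ Igr I 2, q ≠ 0 := by
    apply Submodule.exists_mem_ne_zero_of_ne_bot
    intro h
    rw [h, finrank_bot] at hdim
    omega
  obtain ⟨q', hq', hq'0⟩ := this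
  obtain ⟨hq'h, hq'I⟩ := mem_Igr.mp hq'
  have : ∃ p, eval p q' ≠ 0 := by
    by_contra hc
    push Not at hc
    exact hq'0 (MvPolynomial.funext (fun x => by simpa using hc x))
  obtain ⟨p, hp⟩ := this
  obtain ⟨q₁, hq₁I, hq₁h, hq₁p⟩ : ∃ q₁ ∈ I, q₁.IsHomogeneous 2 ∧ eval p q₁ = 1 :=
    ⟨C (eval p q')⁻¹ * q', I.mul_mem_left _ hq'I, hq'h.C_mul _, by simp [hp]⟩
  have hq₁0 : q₁ ≠ 0 := by
    rintro rfl; simp at hq₁p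
  obtain ⟨b₁, hb₁, hb₁p, hpol₁⟩ := quad_polar p q₁ hq₁h
  have key : ∀ q ∈ I, q.IsHomogeneous 2 → eval p q = 0 → q ≠ 0 →
      ∃ m : MvPolynomial (Fin 4) K, m.IsHomogeneous 1 ∧ m ∣ q ∧ q₁ = m * (b₁ - m) := by
    intro q hqI hqh hqp hq0
    obtain ⟨b, hb, hbp, hpol⟩ := quad_polar p q hqh
    have hid : q ^ 2 - b₁ * b * q + q₁ * b ^ 2 = 0 := by
      apply MvPolynomial.funext
      intro r
      have := res_zero hP p hq₁I hqI hq₁p hqp hb hbp hpol₁ hpol r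
      simpa using this
    have hb0 : b ≠ 0 := by
      rintro rfl
      apply hq0
      simpa using hid
    have hdq : b ∣ q * q := ⟨b₁ * q - q₁ * b, by linear_combination hid⟩
    have hdq' : b ∣ q := (lin_prime hb hb0 hdq).elim id id
    obtain ⟨m, hm, rfl⟩ := hom_factor (n := 1) hqh hb hdq'
    refine ⟨m, hm, Dvd.intro_left _ rfl, ?_⟩
    have h2 : b ^ 2 * (q₁ - m * (b₁ - m)) = 0 := by linear_combination hid
    rcases mul_eq_zero.mp h2 with h | h
    · exact absurd (pow_eq_zero_iff (two_ne_zero) |>.mp h) hb0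
    · exact sub_eq_zero.mp h
  have hsub : ∀ q ∈ I, q.IsHomogeneous 2 →
      (q - C (eval p q) * q₁ ∈ I ∧ (q - C (eval p q) * q₁).IsHomogeneous 2 ∧
        eval p (q - C (eval p q) * q₁) = 0) := fun q hqI hqh =>
    ⟨I.sub_mem hqI (I.mul_mem_left _ hq₁I), hqh.sub (hq₁h.C_mul _), by simp [hq₁p]⟩
  obtain ⟨q₂, hq₂I, hq₂h, hq₂p, hq₂0⟩ : ∃ q ∈ I, q.IsHomogeneous 2 ∧ eval p q = 0 ∧ q ≠ 0 := by
    by_contra hc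
    push Not at hc
    have hle : Igr I 2 ≤ Submodule.span K {q₁} := by
      intro q hq
      obtain ⟨hqh, hqI⟩ := mem_Igr.mp hq
      obtain ⟨a1, a2, a3⟩ := hsub q hqI hqh
      have := hc _ a1 a2 a3
      rw [Submodule.mem_span_singleton]
      exact ⟨eval p q, by rw [smul_eq_C_mul]; exact (sub_eq_zero.mp this).symm⟩
    have h1 := Submodule.finrank_mono hle
    have h2 := finrank_span_singleton (K := K) hq₁0
    omega
  obtain ⟨m₂, hm₂, hd₂, he₂⟩ := key q₂ hq₂I hq₂h hq₂p hq₂0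
  have hor : ∀ q ∈ I, q.IsHomogeneous 2 → eval p q = 0 → m₂ ∣ q ∨ (b₁ - m₂) ∣ q := by
    intro q hqI hqh hqp
    by_cases hq0 : q = 0
    · left; rw [hq0]; exact dvd_zero _
    obtain ⟨m, hm, hd, he⟩ := key q hqI hqh hqp hq0
    have : (m - m₂) * (b₁ - m₂ - m) = 0 := by linear_combination he₂ - he
    rcases mul_eq_zero.mp this with h | h
    · left; rw [← sub_eq_zero.mp h]; exact hd
    · right; rw [sub_eq_zero.mp h]; exact hd
  have hfin : ∀ m : MvPolynomial (Fin 4) K, m ∣ q₁ → m.IsHomogeneous 1 →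
      (∀ q ∈ I, q.IsHomogeneous 2 → eval p q = 0 → m ∣ q) →
      ∃ m : MvPolynomial (Fin 4) K, m.IsHomogeneous 1 ∧ m ≠ 0 ∧
        ∀ q ∈ I, q.IsHomogeneous 2 → m ∣ q := by
    intro m hmq hm hall
    refine ⟨m, hm, ?_, ?_⟩
    · rintro rfl
      exact hq₁0 (zero_dvd_iff.mp hmq)
    · intro q hqI hqh
      obtain ⟨a1, a2, a3⟩ := hsub q hqI hqh
      have := hall _ a1 a2 a3
      exact (dvd_sub_left (hmq.mul_left _)).mp this
  by_cases hcase : ∀ q ∈ I, q.IsHomogeneous 2 → eval p q = 0 → m₂ ∣ q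
  · exact hfin m₂ ⟨_, he₂⟩ hm₂ hcase
  · push Not at hcase
    obtain ⟨q₃, hq₃I, hq₃h, hq₃p, hq₃⟩ := hcase
    have h3 := (hor q₃ hq₃I hq₃h hq₃p).resolve_left hq₃
    refine hfin (b₁ - m₂) ⟨m₂, by rw [he₂]; ring⟩ (hb₁.sub hm₂) ?_
    intro q hqI hqh hqp
    rcases hor q hqI hqh hqp with h | h
    · rcases hor (q + q₃) (I.add_mem hqI hq₃I) (hqh.add hq₃h) (by simp [hqp, hq₃p]) with h' | h'
      · exact absurd ((dvd_add_right h).mp h') hq₃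
      · exact (dvd_add_left h3).mp h'
    · exact h

/-- If `I_2 = m V` and `I_i` is not contained in `(m)`, then `I_i` fills up some line. -/
lemma LineP_of_not_dvd [Infinite K] {I : Ideal (MvPolynomial (Fin 4) K)}
    {m : MvPolynomial (Fin 4) K} (hm : m.IsHomogeneous 1) (h0 : m ≠ 0)
    (hV : Module.finrank K (Wgr I m 1) = 3) {i : ℕ} (hi : 2 ≤ i)
    {F : MvPolynomial (Fin 4) K} (hF : F ∈ I) (hFh : F.IsHomogeneous i) (hFm : ¬ m ∣ F) :
    LineP I i := by
  obtain ⟨U, hUV, hUm⟩ : ∃ U ∈ Wgr I m 1, ¬ m ∣ U := by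
    by_contra hc
    push Not at hc
    have hle : Wgr I m 1 ≤ Submodule.span K {m} := by
      intro g hg
      obtain ⟨c, hc, rfl⟩ := hom_factor (n := 0) (mem_Wgr.mp hg).1 hm (hc g hg)
      rw [← mem_homogeneousSubmodule, homogeneousSubmodule_zero, Submodule.mem_one] at hc
      obtain ⟨y, rfl⟩ := hc
      rw [Submodule.mem_span_singleton]
      exact ⟨y, by rw [smul_eq_C_mul, mul_comm]; rfl⟩
    have h1 := Submodule.finrank_mono hle
    have h2 := finrank_span_singleton (K := K) h0
    omega
  obtain ⟨hUh, hUI⟩ := mem_Wgr.mp hUV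
  have hFU : ¬ m ∣ F * U := fun h => (lin_prime hm h0 h).elim hFm hUm
  obtain ⟨q, hqm, hqFU⟩ := lin_point hm h0 hFU
  rw [map_mul] at hqFU
  have hqF : eval q F ≠ 0 := left_ne_zero_of_mul hqFU
  have hqU : eval q U ≠ 0 := right_ne_zero_of_mul hqFU
  obtain ⟨v, hvV, hv0, hvq⟩ : ∃ v ∈ Wgr I m 1, v ≠ 0 ∧ eval q v = 0 := by
    by_contra hc
    push Not at hc
    have hle : Wgr I m 1 ≤ Submodule.span K {U} := by
      intro g hg
      by_cases hgq : g - (eval q g / eval q U) • U = 0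
      · rw [Submodule.mem_span_singleton]
        exact ⟨_, (sub_eq_zero.mp hgq).symm⟩
      · exfalso
        refine hc _ (Submodule.sub_mem _ hg (Submodule.smul_mem _ _ hUV)) hgq ?_
        simp [smul_eval, hqU]
    have h1 := Submodule.finrank_mono hle
    have h2 := finrank_span_le_card (R := K) ({U} : Set (MvPolynomial (Fin 4) K))
    simp at h2
    omega
  obtain ⟨hvh, hvI⟩ := mem_Wgr.mp hvV
  obtain ⟨p, hp⟩ : ∃ p, eval p (m * v) ≠ 0 := by
    by_contra hc
    push Not at hc
    exact mul_ne_zero h0 hv0 (MvPolynomial.funext (fun x => by simpa using hc x))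
  rw [map_mul] at hp
  have hpm : eval p m ≠ 0 := left_ne_zero_of_mul hp
  have hpv : eval p v ≠ 0 := right_ne_zero_of_mul hp
  have hind : ∃ a b, p a * q b ≠ p b * q a := by
    by_contra hc
    push Not at hc
    have hqa : ∃ a, q a ≠ 0 := by
      by_contra h
      push Not at h
      have hX : ∀ k, (aeval q : MvPolynomial (Fin 4) K →ₐ[K] K) (X k) =
          (0 : Fin 4 → K) k • (0 : K) + (0 : Fin 4 → K) k • (0 : K) := by
        intro k; simp [h k]
      have := lin_map (aeval q) 0 0 _ _ hX U hUh
      exact hqU (by simpa [aeval_eq_eval] using this)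
    obtain ⟨a, ha⟩ := hqa
    have hX : ∀ k, (aeval p : MvPolynomial (Fin 4) K →ₐ[K] K) (X k) =
        q k • (p a / q a) + (0 : Fin 4 → K) k • (0 : K) := by
      intro k
      simp only [aeval_X, smul_eq_mul, Pi.zero_apply, mul_zero, add_zero]
      field_simp
      rw [← hc a k]; ring
    have := lin_map (aeval p) q 0 _ _ hX m hm
    exact hpm (by simpa [aeval_eq_eval, hqm] using this)
  obtain ⟨a, b, hab⟩ := hind
  obtain ⟨l, l', s, t, hl, hl', hX⟩ := line_forms p q hab
  refine ⟨l, l', hl, hl', ?_⟩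
  specialize hX I
  set J := I ⊔ Ideal.span {l, l'} with hJ
  set ψ := Ideal.Quotient.mkₐ K J
  have zI : ∀ f ∈ I, ψ f = 0 := fun f hf =>
    Ideal.Quotient.eq_zero_iff_mem.mpr (Ideal.mem_sup_left hf)
  have zmv := zI _ hvI
  have zmU := zI _ hUI
  rw [map_mul, lin_map ψ p q _ _ hX m hm, lin_map ψ p q _ _ hX v hvh, hqm, hvq] at zmv
  rw [map_mul, lin_map ψ p q _ _ hX m hm, lin_map ψ p q _ _ hX U hUh, hqm] at zmU
  set S := ψ s
  set T := ψ t
  have S2 : S * S = 0 := by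
    simp only [zero_smul, add_zero, smul_mul_smul_comm] at zmv
    exact (smul_eq_zero_iff_right hp).mp zmv
  have ST : S * T = 0 := by
    simp only [zero_smul, add_zero, mul_add, smul_mul_smul_comm, S2, smul_zero, zero_add] at zmU
    exact (smul_eq_zero_iff_right (mul_ne_zero hpm hqU)).mp zmU
  have hall : ∀ f : MvPolynomial (Fin 4) K, f.IsHomogeneous i → ψ f = eval q f • T ^ i := by
    clear hFh
    induction i, hi using Nat.le_induction with
    | base =>
      intro f hf
      obtain ⟨b₂, -, -, h₂⟩ := quad_polar p f hf
      rw [h₂ _ ψ q _ _ hX, ST, pow_two S, S2]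
      simp
    | succ n hn ih =>
      refine hm_succ_induction ?_ ?_
      · intro g f hg hf
        rw [map_mul, lin_map ψ p q _ _ hX g hg, ih f hf, map_mul]
        have : S * T ^ n = 0 := by
          obtain ⟨n', rfl⟩ : ∃ n', n = n' + 1 := ⟨n - 1, by omega⟩
          rw [pow_succ', ← mul_assoc, ST, zero_mul]
        rw [add_mul, smul_mul_smul_comm, smul_mul_smul_comm, this, smul_zero, zero_add, pow_succ']
      · intro f g hf hg
        rw [map_add, hf, hg, map_add, add_smul]
  have hT : T ^ i = 0 := by
    have := hall F hFh
    rw [zI F hF] at this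
    exact (smul_eq_zero_iff_right hqF).mp this.symm
  intro f hf
  apply Ideal.Quotient.eq_zero_iff_mem.mp
  change ψ f = 0
  rw [hall f hf, hT, smul_zero]

lemma hilb_of_dvd {I : Ideal (MvPolynomial (Fin 4) K)} {j : ℕ} (hI : IsAG 4 K I j)
    {m : MvPolynomial (Fin 4) K} (hm : m.IsHomogeneous 1) (h0 : m ≠ 0) (hmI : m ∉ I)
    (hV : Module.finrank K (Wgr I m 1) = 3) {n : ℕ} (hn : n + 1 ≤ j)
    (hdiv : ∀ f ∈ I, f.IsHomogeneous (n + 1) → m ∣ f) :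
    hilb 4 K I (n + 1) = (n + 3).choose 2 + 1 := by
  -- a linear form outside `V`
  have hR1 : Module.finrank K (homogeneousSubmodule (Fin 4) K 1) = 4 := by
    rw [finrank_hm]; rfl
  have hVle : Wgr I m 1 ≤ homogeneousSubmodule (Fin 4) K 1 := inf_le_left
  obtain ⟨u, hu, huV⟩ : ∃ u ∈ homogeneousSubmodule (Fin 4) K 1, u ∉ Wgr I m 1 := by
    by_contra hc
    push Not at hc
    have := Submodule.finrank_mono (show homogeneousSubmodule (Fin 4) K 1 ≤ Wgr I m 1 from hc)
    omega
  have htop : Wgr I m 1 ⊔ Submodule.span K {u} = homogeneousSubmodule (Fin 4) K 1 := by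
    have hle : Wgr I m 1 ⊔ Submodule.span K {u} ≤ homogeneousSubmodule (Fin 4) K 1 :=
      sup_le hVle (by rw [Submodule.span_singleton_le_iff_mem]; exact hu)
    apply Submodule.eq_of_le_of_finrank_le hle
    have hfd : Module.Finite K (Wgr I m 1 ⊔ Submodule.span K {u} : Submodule K _) := inferInstance
    have hlt : Wgr I m 1 < Wgr I m 1 ⊔ Submodule.span K {u} := by
      refine lt_of_le_of_ne le_sup_left (fun h => huV ?_)
      rw [h]
      exact Submodule.mem_sup_right (Submodule.mem_span_singleton_self u)
    have := Submodule.finrank_lt_finrank_of_lt hlt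
    omega
  have hdec : ∀ g : MvPolynomial (Fin 4) K, g.IsHomogeneous 1 →
      ∃ α : K, m * (g - C α * u) ∈ I := by
    intro g hg
    have hg' : g ∈ homogeneousSubmodule (Fin 4) K 1 := hg
    rw [← htop] at hg'
    obtain ⟨v, hv, w, hw, rfl⟩ := Submodule.mem_sup.mp hg'
    obtain ⟨α, rfl⟩ := Submodule.mem_span_singleton.mp hw
    exact ⟨α, by rw [smul_eq_C_mul, add_sub_cancel_right]; exact (mem_Wgr.mp hv).2⟩
  have hpow : ∀ k, ∀ g : MvPolynomial (Fin 4) K, g.IsHomogeneous k →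
      ∃ α : K, m * (g - C α * u ^ k) ∈ I := by
    intro k
    induction k with
    | zero =>
      intro g hg
      rw [← mem_homogeneousSubmodule, homogeneousSubmodule_zero, Submodule.mem_one] at hg
      obtain ⟨y, rfl⟩ := hg
      exact ⟨y, by simp [algebraMap_eq]⟩
    | succ k ih =>
      refine hm_succ_induction ?_ ?_
      · intro g f hg hf
        obtain ⟨α, hα⟩ := hdec g hg
        obtain ⟨β, hβ⟩ := ih f hf
        refine ⟨α * β, ?_⟩
        have : m * (g * f - C (α * β) * u ^ (k + 1)) =
            f * (m * (g - C α * u)) + (C α * u) * (m * (f - C β * u ^ k)) := by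
          rw [C_mul]; ring
        rw [this]
        exact I.add_mem (I.mul_mem_left _ hα) (I.mul_mem_left _ hβ)
      · rintro f g ⟨α, hα⟩ ⟨β, hβ⟩
        refine ⟨α + β, ?_⟩
        have : m * (f + g - C (α + β) * u ^ (k + 1)) =
            m * (f - C α * u ^ (k + 1)) + m * (g - C β * u ^ (k + 1)) := by
          rw [C_add]; ring
        rw [this]
        exact I.add_mem hα hβ
  have hun : m * u ^ n ∉ I := by
    intro h
    have hj : m * u ^ (j - 1) ∈ I := by
      have : m * u ^ (j - 1) = u ^ (j - 1 - n) * (m * u ^ n) := by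
        rw [mul_left_comm, ← pow_add]; congr 2; omega
      rw [this]; exact I.mul_mem_left _ h
    obtain ⟨b, hb, hmb⟩ := nondeg hI (j - 1) 1 (by omega) (Ideal.Quotient.mk I m) (mk_mem_Agr hm)
      (fun h => hmI (Ideal.Quotient.eq_zero_iff_mem.mp h))
    obtain ⟨g, hg, rfl⟩ := mem_Agr.mp hb
    obtain ⟨α, hα⟩ := hpow (j - 1) g hg
    apply hmb
    rw [← map_mul, Ideal.Quotient.eq_zero_iff_mem]
    have : m * g = m * (g - C α * u ^ (j - 1)) + C α * (m * u ^ (j - 1)) := by ring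
    rw [this]
    exact I.add_mem hα (I.mul_mem_left _ hj)
  let μ : MvPolynomial (Fin 4) K →ₗ[K] (MvPolynomial (Fin 4) K ⧸ I) :=
    (Ideal.Quotient.mkₐ K I).toLinearMap ∘ₗ LinearMap.mulLeft K m
  have hμ : ∀ f, μ f = Ideal.Quotient.mk I (m * f) := fun f => rfl
  have hker : homogeneousSubmodule (Fin 4) K n ⊓ LinearMap.ker μ = Wgr I m n := by
    ext f
    rw [mem_Wgr, Submodule.mem_inf, LinearMap.mem_ker, hμ, Ideal.Quotient.eq_zero_iff_mem,
      mem_homogeneousSubmodule]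
  have hrange : (homogeneousSubmodule (Fin 4) K n).map μ = Submodule.span K {μ (u ^ n)} := by
    apply le_antisymm
    · rintro _ ⟨g, hg, rfl⟩
      obtain ⟨α, hα⟩ := hpow n g hg
      rw [Submodule.mem_span_singleton]
      refine ⟨α, ?_⟩
      rw [← map_smul, hμ, hμ, smul_eq_C_mul, eq_comm, Ideal.Quotient.eq, ← mul_sub]
      exact hα
    · rw [Submodule.span_singleton_le_iff_mem]
      refine ⟨u ^ n, ?_, rfl⟩
      have : (u ^ n).IsHomogeneous (1 * n) := IsHomogeneous.pow hu n
      rw [one_mul] at this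
      exact this
  have h1 := finrank_map_add_inf_ker (homogeneousSubmodule (Fin 4) K n) μ
  rw [hker, hrange, finrank_span_singleton, finrank_hm, finrank_Wgr hm h0 hdiv] at h1
  · have h2 := finrank_Igr I (n + 1)
    have h3 : (n + 1 + 3).choose 3 = (n + 3).choose 2 + (n + 3).choose 3 := Nat.choose_succ_succ _ _
    omega
  · intro h
    exact hun (Ideal.Quotient.eq_zero_iff_mem.mp h)

lemma dichotomy [Infinite K] {I : Ideal (MvPolynomial (Fin 4) K)} {j : ℕ} (hI : IsAG 4 K I j)
    (h1 : hilb 4 K I 1 = 4) (h2 : hilb 4 K I 2 = 7) {i : ℕ} (hi : 2 ≤ i) (hij : i ≤ j) :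
    LineP I i ∨ hilb 4 K I i = (i + 2).choose 2 + 1 := by
  by_cases hP : LineP I 3
  · rcases Nat.lt_or_ge i 3 with h | h
    · right
      obtain rfl : i = 2 := by omega
      rw [h2]; rfl
    · exact Or.inl (LineP_mono h hP)
  have hd1 := finrank_Igr I 1
  have hd2 := finrank_Igr I 2
  rw [h1, show Nat.choose (1 + 3) 3 = 4 from rfl] at hd1
  rw [h2, show Nat.choose (2 + 3) 3 = 10 from rfl] at hd2
  obtain ⟨m, hm, h0, hall⟩ := common_factor hP (by omega)
  have hmI : m ∉ I := by
    intro h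
    have hbot : Igr I 1 = ⊥ := Submodule.finrank_eq_zero.mp (by omega)
    have : m ∈ Igr I 1 := mem_Igr.mpr ⟨hm, h⟩
    rw [hbot] at this
    exact h0 (by simpa using this)
  have hV : Module.finrank K (Wgr I m 1) = 3 := by
    rw [finrank_Wgr hm h0 hall, show 1 + 1 = 2 from rfl]; omega
  by_cases hdiv : ∀ f ∈ I, f.IsHomogeneous i → m ∣ f
  · right
    obtain ⟨n, rfl⟩ : ∃ n, i = n + 1 := ⟨i - 1, by omega⟩
    exact hilb_of_dvd hI hm h0 hmI hV hij hdiv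
  · left
    push Not at hdiv
    obtain ⟨F, hF, hFh, hFm⟩ := hdiv
    exact LineP_of_not_dvd hm h0 hV hi hF hFh hFm

end main

/-! ### Macaulay bounds -/

lemma findGreatest_spec' (c d : ℕ) (hc : c ≠ 0) :
    Nat.choose (Nat.findGreatest (fun k => Nat.choose k (d+1) ≤ c) (c + d + 1)) (d+1) ≤ c ∧
    d + 1 ≤ Nat.findGreatest (fun k => Nat.choose k (d+1) ≤ c) (c + d + 1) := by
  constructor
  · exact Nat.findGreatest_spec (P := fun k => Nat.choose k (d+1) ≤ c) (m := 0) (Nat.zero_le _)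
      (by simp)
  · exact Nat.le_findGreatest (by omega) (by simp; omega)

lemma le_macB (d : ℕ) : ∀ c, c ≤ macB c (d + 1) := by
  induction d with
  | zero =>
    intro c
    by_cases hc : c = 0
    · omega
    obtain ⟨ha, -⟩ := findGreatest_spec' c 0 hc
    have hb : c ≤ Nat.findGreatest (fun k => Nat.choose k (0+1) ≤ c) (c + 0 + 1) :=
      Nat.le_findGreatest (by omega) (by simp)
    rw [macB, if_neg hc]
    dsimp only
    have hs := Nat.choose_succ_succ
      (Nat.findGreatest (fun k => Nat.choose k (0+1) ≤ c) (c + 0 + 1)) 1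
    generalize Nat.findGreatest (fun k => Nat.choose k (0+1) ≤ c) (c + 0 + 1) = k at *
    simp only [Nat.succ_eq_add_one, Nat.reduceAdd, Nat.choose_one_right] at *
    omega
  | succ d ih =>
    intro c
    by_cases hc : c = 0
    · omega
    obtain ⟨ha, -⟩ := findGreatest_spec' c (d + 1) hc
    rw [macB, if_neg hc]
    dsimp only
    generalize Nat.findGreatest (fun k => Nat.choose k (d+1+1) ≤ c) (c + (d+1) + 1) = k at *
    have := ih (c - Nat.choose k (d+1+1))
    have hs : Nat.choose (k + 1) (d + 1 + 2) = Nat.choose k (d + 1 + 1) + Nat.choose k (d + 1 + 2) :=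
      Nat.choose_succ_succ _ _
    omega

lemma macB_zero (d : ℕ) : macB 0 d = 0 := by
  cases d <;> simp [macB]

lemma macB_succ (i : ℕ) (hi : 1 ≤ i) : macB (i + 1) i = i + 2 := by
  obtain ⟨d, rfl⟩ : ∃ d, i = d + 1 := ⟨i - 1, by omega⟩
  have hk : Nat.findGreatest (fun k => Nat.choose k (d+1) ≤ d + 1 + 1) (d + 1 + 1 + d + 1)
      = d + 2 := by
    rw [Nat.findGreatest_eq_iff]
    refine ⟨by omega, fun _ => ?_, fun n hn _ => ?_⟩
    · have : Nat.choose (d + 1 + 1) (d + 1) = d + 1 + 1 := Nat.choose_succ_self_right (d + 1)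
      exact this.le
    · have e1 : Nat.choose (d + 3) (d + 1) ≤ Nat.choose n (d + 1) :=
        Nat.choose_le_choose _ (by omega)
      have e2 : Nat.choose (d + 3) (d + 1) = Nat.choose (d + 2) d + Nat.choose (d + 2) (d + 1) :=
        Nat.choose_succ_succ _ _
      have e3 : Nat.choose (d + 1 + 1) (d + 1) = d + 1 + 1 := Nat.choose_succ_self_right (d + 1)
      have e4 : 0 < Nat.choose (d + 2) d := Nat.choose_pos (by omega)
      have e5 : Nat.choose (d + 2) (d + 1) = Nat.choose (d + 1 + 1) (d + 1) := rfl
      show ¬ (Nat.choose n (d + 1) ≤ d + 1 + 1)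
      omega
  rw [macB, if_neg (by omega)]
  dsimp only
  rw [hk]
  have e3 : Nat.choose (d + 2) (d + 1) = d + 1 + 1 := Nat.choose_succ_self_right (d + 1)
  have e4 : Nat.choose (d + 2 + 1) (d + 2) = d + 2 + 1 := Nat.choose_succ_self_right (d + 2)
  rw [e3, e4, Nat.sub_self, macB_zero]


/-- If `A = R/I` is a graded Artinian Gorenstein quotient of
`R = K[w,x,y,z]` of socle degree `j` whose Hilbert function `H` satisfies
`H_1 = 4` and `H_2 = 7`, then `ΔH_{≤ j/2}` is an O-sequence: the first
differences are nonnegative up to degree `⌊j/2⌋` and satisfy Macaulay's growth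
condition. -/
theorem statement_16 {K : Type*} [Field K] [IsAlgClosed K] [CharZero K]
    (j : ℕ) (I : Ideal (MvPolynomial (Fin 4) K))
    (hI : IsAG 4 K I j)
    (h1 : hilb 4 K I 1 = 4) (h2 : hilb 4 K I 2 = 7) :
    DeltaOSeq (hilb 4 K I) (j / 2) := by
  have : Infinite K := inferInstance
  have h0 : hilb 4 K I 0 ≤ 1 := by
    have := finrank_Igr I 0
    rw [show Nat.choose (0 + 3) 3 = 1 from rfl] at this
    omega
  have hval : ∀ i, 1 ≤ i → i ≤ j → ¬ LineP I i → hilb 4 K I i = (i + 2).choose 2 + 1 := by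
    intro i hi hij hP
    rcases Nat.lt_or_ge i 2 with h | h
    · obtain rfl : i = 1 := by omega
      rw [h1]; rfl
    · exact (dichotomy hI h1 h2 h hij).resolve_left hP
  have hch : ∀ n : ℕ, (n + 1).choose 2 = n + n.choose 2 := by
    intro n
    have := Nat.choose_succ_succ n 1
    simpa using this
  refine ⟨?_, by simp, ?_⟩
  · intro i hi hij
    rcases Nat.lt_or_ge i 2 with h | h
    · obtain rfl : i = 1 := by omega
      rw [h1]
      exact h0.trans (by omega)
    by_cases hP : LineP I i
    · exact (LineP_delta hI h hij hP).1
    · obtain ⟨n, rfl⟩ : ∃ n, i = n + 1 := ⟨i - 1, by omega⟩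
      have hP' : ¬ LineP I n := fun h => hP (LineP_mono (by omega) h)
      rw [Nat.add_sub_cancel, hval _ hi (by omega) hP, hval n (by omega) (by omega) hP']
      have := hch (n + 2)
      rw [show n + 1 + 2 = n + 2 + 1 from rfl]
      omega
  · intro i hi hij
    obtain ⟨n, rfl⟩ : ∃ n, i = n + 1 := ⟨i - 1, by omega⟩
    dsimp only
    rw [if_neg (by omega), if_neg (by omega), Nat.add_sub_cancel, Nat.add_sub_cancel]
    rcases Nat.eq_zero_or_pos n with rfl | hn
    · have := le_macB 0 (hilb 4 K I (0 + 1) - hilb 4 K I 0)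
      refine le_trans ?_ this
      simp only [Nat.zero_add, Nat.reduceAdd, h1, h2]
      omega
    by_cases hP : LineP I (n + 1 + 1)
    · have hD := LineP_delta hI (by omega) hij hP
      have := le_macB n (hilb 4 K I (n + 1) - hilb 4 K I n)
      refine le_trans ?_ this
      have e1 : n + 1 + 1 - 1 = n + 1 := rfl
      have e2 : n + 1 + 1 - 2 = n := rfl
      rw [e1, e2] at hD
      omega
    · have hP1 : ¬ LineP I (n + 1) := fun h => hP (LineP_mono (by omega) h)
      have hP2 : ¬ LineP I n := fun h => hP (LineP_mono (by omega) h)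
      have a1 := hval _ (by omega) (by omega) hP
      have a2 := hval _ (by omega) (by omega) hP1
      have a3 := hval n hn (by omega) hP2
      have b1 := hch (n + 3)
      have b2 := hch (n + 2)
      rw [show n + 1 + 1 + 2 = n + 3 + 1 from rfl] at a1
      rw [show n + 1 + 2 = n + 2 + 1 from rfl] at a2
      have c1 : (n + 2 + 1).choose 2 = (n + 3).choose 2 := rfl
      have d1 : hilb 4 K I (n + 1 + 1) - hilb 4 K I (n + 1) = n + 1 + 2 := by omega
      have d2 : hilb 4 K I (n + 1) - hilb 4 K I n = n + 1 + 1 := by omega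
      rw [d1, d2, macB_succ _ (by omega)]

end
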